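/- Let f and g be two holomorphic local dynamical systems at 0 ∈ ℂ with the same multiplier e^{2πip/q} (a q-th root of unity). Then f and g are holomorphically locally conjugated if and only if the iterates f^q and g^q are holomorphically locally conjugated. -/

import Mathlib

open Set Filter Topology

/-- `φ` is a biholomorphism from `W₁` onto `W₂` fixing `0` which conjugates the holomorphic
local dynamical system `f₁` (defined on `U₁`) to `f₂` (defined on `U₂`). -/
def IsHolConjVia (f₁ : ℂ → ℂ) (U₁ : Set ℂ) (f₂ : ℂ → ℂ) (U₂ : Set ℂ)
    (φ : ℂ → ℂ) (W₁ W₂ : Set ℂ) : Prop :=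
  IsOpen W₁ ∧ IsOpen W₂ ∧ (0 : ℂ) ∈ W₁ ∧ (0 : ℂ) ∈ W₂ ∧ W₁ ⊆ U₁ ∧ W₂ ⊆ U₂ ∧
    DifferentiableOn ℂ φ W₁ ∧ Set.BijOn φ W₁ W₂ ∧
    (∃ ψ : ℂ → ℂ, DifferentiableOn ℂ ψ W₂ ∧ Set.EqOn (ψ ∘ φ) id W₁) ∧
    φ 0 = 0 ∧ ∀ z ∈ W₁, f₁ z ∈ W₁ → φ (f₁ z) = f₂ (φ z)

/-- `f₁` and `f₂` are holomorphically locally conjugated at `0`. -/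
def HolLocallyConj (f₁ : ℂ → ℂ) (U₁ : Set ℂ) (f₂ : ℂ → ℂ) (U₂ : Set ℂ) : Prop :=
  ∃ φ W₁ W₂, IsHolConjVia f₁ U₁ f₂ U₂ φ W₁ W₂

/-- The natural domain of definition of the `q`-th iterate of `f : U → ℂ`: the points whose
first `q` iterates stay in `U`. -/
def iterDomain (f : ℂ → ℂ) (U : Set ℂ) (q : ℕ) : Set ℂ :=
  {z | ∀ k, k < q → f^[k] z ∈ U}

open Asymptotics

/-- If `A z = z ^ (j + 1) * A₁ z` near `0`, and `x`, `y` are two functions equivalent to `Λ z`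
with difference `c z ^ k + o(z ^ k)`, then `A ∘ x - A ∘ y` is
`(j + 1) A₁(0) Λ ^ j c z ^ (k + j)` up to higher order terms. -/
lemma tendsto_comp_sub_comp_div {A A₁ x y : ℂ → ℂ} {j k : ℕ} {Λ c : ℂ}
    (hA : ∀ᶠ z in 𝓝 0, A z = z ^ (j + 1) * A₁ z) (hA₁ : AnalyticAt ℂ A₁ 0)
    (hx : Tendsto (fun z => x z / z) (𝓝[≠] 0) (𝓝 Λ))
    (hy : Tendsto (fun z => y z / z) (𝓝[≠] 0) (𝓝 Λ))
    (hxy : Tendsto (fun z => (x z - y z) / z ^ k) (𝓝[≠] 0) (𝓝 c)) :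
    Tendsto (fun z => (A (x z) - A (y z)) / z ^ (k + j)) (𝓝[≠] 0)
      (𝓝 ((j + 1) * A₁ 0 * Λ ^ j * c)) := by
  have hz : Tendsto (fun z : ℂ => z) (𝓝[≠] 0) (𝓝 0) :=
    tendsto_nhdsWithin_of_tendsto_nhds tendsto_id
  have hne : ∀ᶠ z : ℂ in 𝓝[≠] 0, z ≠ 0 := eventually_mem_nhdsWithin
  have to_zero : ∀ u : ℂ → ℂ, Tendsto (fun z => u z / z) (𝓝[≠] 0) (𝓝 Λ) →
      Tendsto u (𝓝[≠] 0) (𝓝 0) := by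
    intro u hu
    have := hu.mul hz
    rw [mul_zero] at this
    refine this.congr' ?_
    filter_upwards [hne] with z hz
    field_simp
  have hx0 := to_zero x hx
  have hy0 := to_zero y hy
  have hsum : Tendsto (fun z => ∑ i ∈ Finset.range (j + 1), (x z / z) ^ i * (y z / z) ^ (j + 1 - 1 - i))
      (𝓝[≠] 0) (𝓝 ((j + 1) * Λ ^ j)) := by
    have : ((j + 1) * Λ ^ j : ℂ) = ∑ i ∈ Finset.range (j + 1), Λ ^ i * Λ ^ (j + 1 - 1 - i) := by
      rw [Finset.sum_congr rfl (g := fun _ => Λ ^ j)]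
      · simp
      · intro i hi
        rw [← pow_add]
        congr 1
        have := Finset.mem_range.1 hi
        omega
    rw [this]
    exact tendsto_finsetSum _ fun i _ => (hx.pow i).mul (hy.pow _)
  have hAx : Tendsto (fun z => A₁ (x z)) (𝓝[≠] 0) (𝓝 (A₁ 0)) :=
    hA₁.continuousAt.tendsto.comp hx0
  have hO : (fun z => A₁ (x z) - A₁ (y z)) =O[𝓝[≠] 0] fun z => x z - y z := by
    have h := hA₁.hasStrictDerivAt.hasStrictFDerivAt.isBigO_sub
    have hp : Tendsto (fun z => (x z, y z)) (𝓝[≠] 0) (𝓝 ((0 : ℂ), (0 : ℂ))) :=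
      hx0.prodMk_nhds hy0
    exact h.comp_tendsto hp
  have hrem : Tendsto (fun z => z * ((A₁ (x z) - A₁ (y z)) / z ^ k)) (𝓝[≠] 0) (𝓝 0) := by
    have h1 : (fun z => (A₁ (x z) - A₁ (y z)) / z ^ k) =O[𝓝[≠] 0] fun _ => (1 : ℂ) := by
      have h2 : (fun z => (A₁ (x z) - A₁ (y z)) / z ^ k) =O[𝓝[≠] 0]
          fun z => (x z - y z) / z ^ k := by
        simp only [div_eq_mul_inv]
        exact hO.mul (isBigO_refl _ _)
      exact h2.trans (hxy.isBigO_one ℂ)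
    have h3 := ((isLittleO_one_iff ℂ).2 hz).mul_isBigO h1
    simpa using (isLittleO_one_iff ℂ).1 (by simpa using h3)
  have key := ((hxy.mul hsum).mul hAx).add ((hy.pow (j + 1)).mul hrem)
  have hval : c * ((j + 1) * Λ ^ j) * A₁ 0 + Λ ^ (j + 1) * 0 = (j + 1) * A₁ 0 * Λ ^ j * c := by
    ring
  rw [hval] at key
  refine key.congr' ?_
  filter_upwards [hne, hx0.eventually hA, hy0.eventually hA] with z hz hAx hAy
  have hg := (Commute.all (x z / z) (y z / z)).mul_geom_sum₂ (j + 1)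
  have hg' : (x z - y z) * ∑ i ∈ Finset.range (j + 1), (x z / z) ^ i * (y z / z) ^ (j + 1 - 1 - i) =
      z * ((x z / z) ^ (j + 1) - (y z / z) ^ (j + 1)) := by
    rw [← hg]
    field_simp
  rw [div_mul_eq_mul_div, hg', hAx, hAy]
  simp only [div_pow]
  field_simp
  ring

lemma tendsto_div_of_hasDerivAt {f : ℂ → ℂ} {a : ℂ} (hf : HasDerivAt f a 0) (hf0 : f 0 = 0) :
    Tendsto (fun z => f z / z) (𝓝[≠] 0) (𝓝 a) := by
  have := hf.tendsto_slope
  refine this.congr fun z => ?_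
  simp [slope_def_field, hf0]

/-- An analytic germ vanishing at `0`, but not identically, has a finite positive order. -/
lemma exists_eq_pow_succ_mul {d : ℂ → ℂ} (hd : AnalyticAt ℂ d 0) (hd0 : d 0 = 0)
    (hne : ¬ ∀ᶠ z in 𝓝 0, d z = 0) :
    ∃ (j : ℕ) (e : ℂ → ℂ), AnalyticAt ℂ e 0 ∧ e 0 ≠ 0 ∧ ∀ᶠ z in 𝓝 0, d z = z ^ (j + 1) * e z := by
  obtain ⟨n, e, he, he0, h⟩ := hd.exists_eventuallyEq_pow_smul_nonzero_iff.2 hne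
  obtain _ | j := n
  · have := h.self_of_nhds
    simp [hd0] at this
    exact absurd this.symm he0
  · exact ⟨j, e, he, he0, by simpa using h⟩

lemma analyticAt_iterate {f : ℂ → ℂ} (hf : AnalyticAt ℂ f 0) (hf0 : f 0 = 0) (k : ℕ) :
    AnalyticAt ℂ f^[k] 0 := by
  induction k with
  | zero => exact analyticAt_id
  | succ k ih =>
    rw [Function.iterate_succ]
    exact AnalyticAt.comp (by rwa [hf0]) hf

lemma tendsto_zero_of_analyticAt {f : ℂ → ℂ} (hf : AnalyticAt ℂ f 0) (hf0 : f 0 = 0) :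
    Tendsto f (𝓝 0) (𝓝 0) := by
  simpa [hf0] using hf.continuousAt.tendsto

/-- Two germs whose multiplier is a `q`-th root of unity and whose `q`-th iterates coincide and are
not the identity must themselves coincide. -/
lemma eventuallyEq_of_iterate_eventuallyEq {f g : ℂ → ℂ} {q : ℕ} {lam : ℂ} (hq : 1 ≤ q)
    (hlam : lam ^ q = 1) (hf : AnalyticAt ℂ f 0) (hg : AnalyticAt ℂ g 0)
    (hf0 : f 0 = 0) (hg0 : g 0 = 0) (hmf : deriv f 0 = lam) (hmg : deriv g 0 = lam)
    (hfg : f^[q] =ᶠ[𝓝 0] g^[q]) (hid : ¬ f^[q] =ᶠ[𝓝 0] id) : f =ᶠ[𝓝 0] g := by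
  have hnorm : ‖lam‖ = 1 := Complex.norm_eq_one_of_pow_eq_one hlam (by omega)
  have hlam0 : lam ≠ 0 := by
    rintro rfl
    simp at hnorm
  have hfd : HasDerivAt f lam 0 := hmf ▸ hf.differentiableAt.hasDerivAt
  have hgd : HasDerivAt g lam 0 := hmg ▸ hg.differentiableAt.hasDerivAt
  have hgt := tendsto_zero_of_analyticAt hg hg0
  have hit : ∀ {u : ℂ → ℂ}, HasDerivAt u lam 0 → u 0 = 0 → ∀ k,
      Tendsto (fun z => u^[k] z / z) (𝓝[≠] 0) (𝓝 (lam ^ k)) := fun hu hu0 k =>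
    tendsto_div_of_hasDerivAt (HasDerivAt.iterate 0 hu hu0 k) (Function.iterate_fixed hu0 k)
  have hF := analyticAt_iterate hf hf0 q
  have hF0 : f^[q] 0 = 0 := Function.iterate_fixed hf0 q
  have hzt : Tendsto (fun z : ℂ => z) (𝓝[≠] 0) (𝓝 0) :=
    tendsto_nhdsWithin_of_tendsto_nhds tendsto_id
  have hne : ∀ᶠ z : ℂ in 𝓝[≠] 0, z ≠ 0 := eventually_mem_nhdsWithin
  by_contra hcon
  obtain ⟨j, d, hd, hd0, hdeq⟩ := exists_eq_pow_succ_mul (d := fun z => f z - g z) (hf.sub hg)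
    (by simp [hf0, hg0]) (fun h => hcon (h.mono fun z hz => sub_eq_zero.1 hz))
  obtain ⟨m, a, ha, ha0, haeq⟩ := exists_eq_pow_succ_mul (d := fun z => f^[q] z - z)
    (hF.sub analyticAt_id) (by simp [hF0]) (fun h => hid (h.mono fun z hz => sub_eq_zero.1 hz))
  have leading : ∀ {b e : ℂ → ℂ} {i : ℕ}, AnalyticAt ℂ e 0 →
      (∀ᶠ z in 𝓝 0, b z = z ^ (i + 1) * e z) →
      Tendsto (fun z => b z / z ^ (i + 1)) (𝓝[≠] 0) (𝓝 (e 0)) := by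
    intro b e i he hb
    refine (he.continuousAt.tendsto.comp hzt).congr' ?_
    filter_upwards [hne, hzt.eventually hb] with z hz hb
    simp only [Function.comp]
    rw [hb]
    field_simp
  have hdlim := leading hd hdeq
  have halim := leading ha haeq
  have hid1 : Tendsto (fun z : ℂ => z / z) (𝓝[≠] 0) (𝓝 1) :=
    tendsto_const_nhds.congr' (by filter_upwards [hne] with z hz; field_simp)
  have hF1 : Tendsto (fun z => f^[q] z / z) (𝓝[≠] 0) (𝓝 1) := hlam ▸ hit hfd hf0 q
  -- Compare the leading terms in `(f - g) ∘ F - (f - g) = (F - id) ∘ f - (F - id) ∘ g`.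
  have h1 := tendsto_comp_sub_comp_div hdeq hd hF1 hid1 halim
  have h2 := tendsto_comp_sub_comp_div haeq ha
    (tendsto_div_of_hasDerivAt hfd hf0) (tendsto_div_of_hasDerivAt hgd hg0) hdlim
  have hcomm : ((j : ℂ) + 1) * d 0 * 1 ^ j * a 0 = (m + 1) * a 0 * lam ^ m * d 0 := by
    refine tendsto_nhds_unique h1 (h2.congr' ?_)
    filter_upwards [hzt.eventually hfg, hzt.eventually (hgt.eventually hfg)] with z hz hgz
    have e1 : f^[q] (f z) = f (f^[q] z) := by
      rw [← Function.iterate_succ_apply, Function.iterate_succ_apply']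
    have e2 : f^[q] (g z) = g (f^[q] z) := by
      rw [hgz, hz, ← Function.iterate_succ_apply, Function.iterate_succ_apply']
    rw [e1, e2]
    congr 1
    · ring
    · ring
  have hjm : ((j : ℂ) + 1) = (m + 1) * lam ^ m := by
    have : (a 0 * d 0) * ((j : ℂ) + 1) = (a 0 * d 0) * ((m + 1) * lam ^ m) := by
      linear_combination hcomm
    exact mul_left_cancel₀ (mul_ne_zero ha0 hd0) this
  have hjm' : j = m := by
    have := congrArg norm hjm
    rw [norm_mul, norm_pow, hnorm] at this
    norm_cast at this
    simpa using this
  subst hjm'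
  have hlamj : lam ^ j = 1 := by
    have hj : ((j : ℂ) + 1) ≠ 0 := by exact_mod_cast Nat.succ_ne_zero j
    have : ((j : ℂ) + 1) * lam ^ j = (j + 1) * 1 := by rw [← hjm, mul_one]
    exact mul_left_cancel₀ hj this
  -- The leading term of `f^[k] - g^[k]` is `k` times a nonzero constant.
  have hiter : ∀ k : ℕ, Tendsto (fun z => (f^[k + 1] z - g^[k + 1] z) / z ^ (j + 1)) (𝓝[≠] 0)
      (𝓝 ((k + 1) * lam ^ k * d 0)) := by
    intro k
    induction k with
    | zero => simpa using hdlim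
    | succ k ih =>
      have hslope : AnalyticAt ℂ (dslope f 0) 0 := by
        obtain ⟨p, hp⟩ := hf
        exact hp.has_fpower_series_dslope_fslope.analyticAt
      have hfslope : ∀ᶠ z in 𝓝 0, f z = z ^ (0 + 1) * dslope f 0 z :=
        Eventually.of_forall fun z => by simpa [hf0] using (sub_smul_dslope f 0 z).symm
      have hG := hit hgd hg0 (k + 1)
      have hGt : Tendsto g^[k + 1] (𝓝[≠] 0) (𝓝 0) :=
        (tendsto_zero_of_analyticAt (analyticAt_iterate hg hg0 _)
          (Function.iterate_fixed hg0 _)).mono_left nhdsWithin_le_nhds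
      have t1 := tendsto_comp_sub_comp_div hfslope hslope (hit hfd hf0 (k + 1)) hG ih
      have t2 : Tendsto (fun z => (g^[k + 1] z / z) ^ (j + 1) * d (g^[k + 1] z)) (𝓝[≠] 0)
          (𝓝 ((lam ^ (k + 1)) ^ (j + 1) * d 0)) :=
        (hG.pow _).mul (hd.continuousAt.tendsto.comp hGt)
      have hval : (((0 : ℕ) : ℂ) + 1) * dslope f 0 0 * (lam ^ (k + 1)) ^ 0 * ((k + 1) * lam ^ k * d 0) +
          (lam ^ (k + 1)) ^ (j + 1) * d 0 = ((k + 1 : ℕ) + 1) * lam ^ (k + 1) * d 0 := by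
        have : (lam ^ (k + 1)) ^ (j + 1) = lam ^ (k + 1) := by
          rw [pow_succ, ← pow_mul, mul_comm, pow_mul', hlamj, one_pow, mul_one]
        rw [this, dslope_same, hmf]
        push_cast
        ring
      rw [← hval]
      refine (t1.add t2).congr' ?_
      filter_upwards [hGt.eventually hdeq, hne] with z hz hz0
      rw [Function.iterate_succ_apply' f (k + 1), Function.iterate_succ_apply' g (k + 1)]
      have : g (g^[k + 1] z) =
          f (g^[k + 1] z) - g^[k + 1] z ^ (j + 1) * d (g^[k + 1] z) := by
        rw [← hz]
        ring
      rw [this, div_pow]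
      field_simp
      ring
  obtain ⟨k, rfl⟩ : ∃ k, q = k + 1 := ⟨q - 1, by omega⟩
  have hzero : ((k : ℂ) + 1) * lam ^ k * d 0 = 0 := by
    refine tendsto_nhds_unique (hiter k) (tendsto_const_nhds.congr' ?_)
    filter_upwards [hzt.eventually hfg] with z hz
    rw [hz]
    simp
  have hk : ((k : ℂ) + 1) ≠ 0 := by exact_mod_cast Nat.succ_ne_zero k
  exact mul_ne_zero (mul_ne_zero hk (pow_ne_zero _ hlam0)) hd0 hzero

/-- Holomorphic conjugacy of germs at the fixed point `0`. -/
def GermConj (f g : ℂ → ℂ) : Prop :=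
  ∃ φ : ℂ → ℂ, AnalyticAt ℂ φ 0 ∧ φ 0 = 0 ∧ deriv φ 0 ≠ 0 ∧ φ ∘ f =ᶠ[𝓝 0] g ∘ φ

lemma exists_local_inverse {φ : ℂ → ℂ} (hφ : AnalyticAt ℂ φ 0) (hφ0 : φ 0 = 0)
    (hφ' : deriv φ 0 ≠ 0) :
    ∃ ψ : ℂ → ℂ, AnalyticAt ℂ ψ 0 ∧ ψ 0 = 0 ∧ deriv ψ 0 = (deriv φ 0)⁻¹ ∧
      (∀ᶠ z in 𝓝 0, ψ (φ z) = z) ∧ ∀ᶠ z in 𝓝 0, φ (ψ z) = z := by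
  have hl := HasStrictDerivAt.eventually_left_inverse hφ.hasStrictDerivAt hφ'
  have hr := HasStrictDerivAt.eventually_right_inverse hφ.hasStrictDerivAt hφ'
  have ha := hφ.analyticAt_localInverse hφ'
  have hd := (HasStrictDerivAt.to_localInverse hφ.hasStrictDerivAt hφ').hasDerivAt.deriv
  have h0 := hl.self_of_nhds
  rw [hφ0] at hr ha hd h0
  exact ⟨_, ha, h0, hd, hl, hr⟩

lemma HolLocallyConj.germConj {f g : ℂ → ℂ} {U V : Set ℂ} (h : HolLocallyConj f U g V)
    (hf : Tendsto f (𝓝 0) (𝓝 0)) : GermConj f g := by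
  obtain ⟨φ, W₁, W₂, hW₁, hW₂, h01, h02, -, -, hφ, -, ⟨ψ, hψ, hψφ⟩, hφ0, hconj⟩ := h
  have hmem := hW₁.mem_nhds h01
  refine ⟨φ, hφ.analyticAt hmem, hφ0, fun h => ?_, ?_⟩
  · have h1 : HasDerivAt φ (deriv φ 0) 0 := (hφ.differentiableAt hmem).hasDerivAt
    have h2 : HasDerivAt ψ (deriv ψ 0) (φ 0) := by
      rw [hφ0]
      exact (hψ.differentiableAt (hW₂.mem_nhds h02)).hasDerivAt
    have h3 : ψ ∘ φ =ᶠ[𝓝 0] id := eventually_of_mem hmem hψφ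
    have h4 := (h2.comp 0 h1).unique ((hasDerivAt_id (0 : ℂ)).congr_of_eventuallyEq h3)
    simp [h] at h4
  · filter_upwards [hmem, hf.eventually_mem hmem] with z hz hfz
    exact hconj z hz hfz

lemma GermConj.holLocallyConj {f g : ℂ → ℂ} {U V : Set ℂ} (h : GermConj f g)
    (hU : U ∈ 𝓝 0) (hV : V ∈ 𝓝 0) : HolLocallyConj f U g V := by
  obtain ⟨φ, hφ, hφ0, hφ', hconj⟩ := h
  obtain ⟨ψ, hψ, hψ0, -, hl, hr⟩ := exists_local_inverse hφ hφ0 hφ'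
  have hφt := tendsto_zero_of_analyticAt hφ hφ0
  obtain ⟨T, hT, hTo, h0T⟩ := eventually_nhds_iff.1 (hψ.eventually_analyticAt.and hr)
  obtain ⟨W, hW, hWo, h0W⟩ := eventually_nhds_iff.1
    (hφ.eventually_analyticAt.and (hl.and (hconj.and ((eventually_mem_set.2 hU).and
      ((hφt.eventually_mem hV).and (hφt.eventually_mem (hTo.mem_nhds h0T)))))))
  have hψc : ContinuousOn ψ T := fun z hz => (hT z hz).1.continuousAt.continuousWithinAt
  refine ⟨φ, W, T ∩ ψ ⁻¹' W, hWo, hψc.isOpen_inter_preimage hTo hWo, h0W,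
    ⟨h0T, by simpa [hψ0] using h0W⟩, fun z hz => (hW z hz).2.2.2.1, ?_,
    fun z hz => (hW z hz).1.differentiableAt.differentiableWithinAt, ⟨?_, ?_, ?_⟩,
    ⟨ψ, fun z hz => (hT z hz.1).1.differentiableAt.differentiableWithinAt,
      fun z hz => (hW z hz).2.1⟩, hφ0, fun z hz _ => (hW z hz).2.2.1⟩
  · intro w hw
    rw [← (hT w hw.1).2]
    exact (hW _ hw.2).2.2.2.2.1
  · intro z hz
    refine ⟨(hW z hz).2.2.2.2.2, ?_⟩
    rw [mem_preimage, (hW z hz).2.1]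
    exact hz
  · intro z hz w hw h
    rw [← (hW z hz).2.1, h, (hW w hw).2.1]
  · exact fun w hw => ⟨ψ w, hw.2, (hT w hw.1).2⟩

lemma eventually_comp_iterate {f g φ : ℂ → ℂ} (hf : Tendsto f (𝓝 0) (𝓝 0))
    (h : φ ∘ f =ᶠ[𝓝 0] g ∘ φ) (k : ℕ) : φ ∘ f^[k] =ᶠ[𝓝 0] g^[k] ∘ φ := by
  induction k with
  | zero => rfl
  | succ k ih =>
    filter_upwards [h, hf.eventually ih] with z hz hz'
    simp only [Function.comp, Function.iterate_succ_apply] at hz hz' ⊢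
    rw [hz', hz]

lemma GermConj.iterate {f g : ℂ → ℂ} (hf : Tendsto f (𝓝 0) (𝓝 0)) (h : GermConj f g) (k : ℕ) :
    GermConj f^[k] g^[k] := by
  obtain ⟨φ, hφ, hφ0, hφ', hconj⟩ := h
  exact ⟨φ, hφ, hφ0, hφ', eventually_comp_iterate hf hconj k⟩

/-- A germ of finite order is linearizable, by averaging. -/
lemma germConj_mul_of_iterate_eventuallyEq_id {f : ℂ → ℂ} {q : ℕ} {lam : ℂ} (hq : 1 ≤ q)
    (hlam : lam ^ q = 1) (hf : AnalyticAt ℂ f 0) (hf0 : f 0 = 0) (hmf : deriv f 0 = lam)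
    (hid : f^[q] =ᶠ[𝓝 0] id) : GermConj f (fun z => lam * z) := by
  have hlam0 : lam ≠ 0 := by
    rintro rfl
    rw [zero_pow (by omega)] at hlam
    exact zero_ne_one hlam
  have hfd : HasDerivAt f lam 0 := hmf ▸ hf.differentiableAt.hasDerivAt
  refine ⟨fun z => ∑ k ∈ Finset.range q, (lam ^ k)⁻¹ * f^[k] z, ?_, ?_, ?_, ?_⟩
  · exact Finset.analyticAt_fun_sum _ fun k _ => analyticAt_const.mul (analyticAt_iterate hf hf0 k)
  · exact Finset.sum_eq_zero fun k _ => by rw [Function.iterate_fixed hf0, mul_zero]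
  · have : HasDerivAt (fun z => ∑ k ∈ Finset.range q, (lam ^ k)⁻¹ * f^[k] z)
        (∑ k ∈ Finset.range q, (lam ^ k)⁻¹ * lam ^ k) 0 :=
      HasDerivAt.fun_sum fun k _ => (HasDerivAt.iterate 0 hfd hf0 k).const_mul _
    rw [this.deriv, Finset.sum_congr rfl fun k _ => inv_mul_cancel₀ (pow_ne_zero k hlam0)]
    simp only [Finset.sum_const, Finset.card_range, nsmul_eq_mul, mul_one]
    exact_mod_cast (by omega : q ≠ 0)
  · filter_upwards [hid] with z hz
    have h1 := Finset.sum_range_succ' (fun k => lam * ((lam ^ k)⁻¹ * f^[k] z)) q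
    rw [Finset.sum_range_succ, hz, hlam, pow_zero, Function.iterate_zero] at h1
    simp only [Function.comp, Finset.mul_sum]
    rw [add_right_cancel h1]
    refine Finset.sum_congr rfl fun k _ => ?_
    rw [← Function.iterate_succ_apply, pow_succ']
    field_simp

lemma GermConj.symm {f g : ℂ → ℂ} (hf : Tendsto f (𝓝 0) (𝓝 0))
    (h : GermConj f g) : GermConj g f := by
  obtain ⟨φ, hφ, hφ0, hφ', hconj⟩ := h
  obtain ⟨ψ, hψ, hψ0, hψ', hl, hr⟩ := exists_local_inverse hφ hφ0 hφ'
  have hψt := tendsto_zero_of_analyticAt hψ hψ0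
  refine ⟨ψ, hψ, hψ0, hψ' ▸ inv_ne_zero hφ', ?_⟩
  filter_upwards [hψt.eventually hconj, hr, (hf.comp hψt).eventually hl] with z hz hz' hz''
  simp only [Function.comp] at hz hz'' ⊢
  rw [← hz'', hz, hz']

lemma GermConj.trans {f g h : ℂ → ℂ} (hfg : GermConj f g) (hgh : GermConj g h) : GermConj f h := by
  obtain ⟨φ, hφ, hφ0, hφ', hφc⟩ := hfg
  obtain ⟨ψ, hψ, hψ0, hψ', hψc⟩ := hgh
  have hψφ : AnalyticAt ℂ ψ (φ 0) := by rwa [hφ0]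
  refine ⟨ψ ∘ φ, hψφ.comp hφ, by simp [hφ0, hψ0], ?_, ?_⟩
  · rw [deriv_comp 0 hψφ.differentiableAt hφ.differentiableAt, hφ0]
    exact mul_ne_zero hψ' hφ'
  · filter_upwards [hφc, (tendsto_zero_of_analyticAt hφ hφ0).eventually hψc] with z hz hz'
    simp only [Function.comp] at hz hz' ⊢
    rw [hz, hz']

lemma GermConj.of_iterate {f g : ℂ → ℂ} {q : ℕ} {lam : ℂ} (hq : 1 ≤ q)
    (hlam : lam ^ q = 1) (hf : AnalyticAt ℂ f 0) (hg : AnalyticAt ℂ g 0)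
    (hf0 : f 0 = 0) (hg0 : g 0 = 0) (hmf : deriv f 0 = lam) (hmg : deriv g 0 = lam)
    (h : GermConj f^[q] g^[q]) : GermConj f g := by
  have hgt := tendsto_zero_of_analyticAt hg hg0
  obtain ⟨φ, hφ, hφ0, hφ', hconj⟩ := h
  obtain ⟨ψ, hψ, hψ0, hψ', hl, hr⟩ := exists_local_inverse hφ hφ0 hφ'
  have hφt := tendsto_zero_of_analyticAt hφ hφ0
  have hψt := tendsto_zero_of_analyticAt hψ hψ0
  by_cases hid : f^[q] =ᶠ[𝓝 0] id
  · have hidg : g^[q] =ᶠ[𝓝 0] id := by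
      filter_upwards [hr, hψt.eventually hconj, hψt.eventually hid] with z h1 h2 h3
      simp only [Function.comp, id] at h2 h3 ⊢
      rw [h3, h1] at h2
      exact h2.symm
    exact (germConj_mul_of_iterate_eventuallyEq_id hq hlam hf hf0 hmf hid).trans
      ((germConj_mul_of_iterate_eventuallyEq_id hq hlam hg hg0 hmg hidg).symm hgt)
  · have hgφ : AnalyticAt ℂ (g ∘ φ) 0 := AnalyticAt.comp (by rwa [hφ0]) hφ
    have hgφ0 : (g ∘ φ) 0 = 0 := by simp [hφ0, hg0]
    have hG : AnalyticAt ℂ (ψ ∘ g ∘ φ) 0 := AnalyticAt.comp (by rwa [hgφ0]) hgφ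
    have hG0 : (ψ ∘ g ∘ φ) 0 = 0 := by simp [hφ0, hg0, hψ0]
    have hGd : deriv (ψ ∘ g ∘ φ) 0 = lam := by
      have h1 := hφ.differentiableAt.hasDerivAt
      have h2 : HasDerivAt g lam (φ 0) := by
        rw [hφ0, ← hmg]
        exact hg.differentiableAt.hasDerivAt
      have h3 : HasDerivAt ψ (deriv ψ 0) ((g ∘ φ) 0) := by
        rw [hgφ0]
        exact hψ.differentiableAt.hasDerivAt
      rw [(h3.comp 0 (h2.comp 0 h1)).deriv, hψ']
      field_simp
    have hGconj : φ ∘ (ψ ∘ g ∘ φ) =ᶠ[𝓝 0] g ∘ φ := (hgt.comp hφt).eventually hr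
    have hGt := tendsto_zero_of_analyticAt hG hG0
    have hGq := eventually_comp_iterate hGt hGconj q
    have hGqt := tendsto_zero_of_analyticAt (analyticAt_iterate hG hG0 q)
      (Function.iterate_fixed hG0 q)
    have hFqt := tendsto_zero_of_analyticAt (analyticAt_iterate hf hf0 q)
      (Function.iterate_fixed hf0 q)
    have heq : f^[q] =ᶠ[𝓝 0] (ψ ∘ g ∘ φ)^[q] := by
      filter_upwards [hGq, hconj, hGqt.eventually hl, hFqt.eventually hl] with z h1 h2 h3 h4
      rw [← h3, ← h4]
      exact congrArg ψ (h2.trans h1.symm)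
    have hfG := eventuallyEq_of_iterate_eventuallyEq hq hlam hf hG hf0 hG0 hmf hGd heq hid
    exact ⟨φ, hφ, hφ0, hφ', (hfG.fun_comp φ).trans hGconj⟩

lemma iterDomain_mem_nhds {f : ℂ → ℂ} {U : Set ℂ} (hf : AnalyticAt ℂ f 0) (hf0 : f 0 = 0)
    (hU : U ∈ 𝓝 0) (q : ℕ) : iterDomain f U q ∈ 𝓝 0 := by
  have : ∀ᶠ z in 𝓝 0, ∀ k ∈ Set.Iio q, f^[k] z ∈ U :=
    (eventually_all_finite (Set.finite_Iio q)).2 fun k _ =>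
      (tendsto_zero_of_analyticAt (analyticAt_iterate hf hf0 k)
        (Function.iterate_fixed hf0 k)).eventually_mem hU
  exact this

/-- Two holomorphic local dynamical systems at `0 ∈ ℂ` with the same multiplier
`e^{2πip/q}` (a `q`-th root of unity) are holomorphically locally conjugated if and only if
their `q`-th iterates are. -/
theorem holConj_iff_holConj_of_iterates
    (f g : ℂ → ℂ) (U V : Set ℂ)
    (hU : IsOpen U) (h0U : (0 : ℂ) ∈ U) (hf : DifferentiableOn ℂ f U)
    (hf0 : f 0 = 0) (hfne : ∃ z ∈ U, f z ≠ z)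
    (hV : IsOpen V) (h0V : (0 : ℂ) ∈ V) (hg : DifferentiableOn ℂ g V)
    (hg0 : g 0 = 0) (hgne : ∃ z ∈ V, g z ≠ z)
    (q : ℕ) (hq : 1 ≤ q) (lam : ℂ) (hlam : lam ^ q = 1)
    (hmf : deriv f 0 = lam) (hmg : deriv g 0 = lam) :
    HolLocallyConj f U g V ↔
      HolLocallyConj (f^[q]) (iterDomain f U q) (g^[q]) (iterDomain g V q) := by
  have hUn := hU.mem_nhds h0U
  have hVn := hV.mem_nhds h0V
  have hfa := hf.analyticAt hUn
  have hga := hg.analyticAt hVn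
  constructor
  · intro h
    have hft := tendsto_zero_of_analyticAt hfa hf0
    exact ((h.germConj hft).iterate hft q).holLocallyConj (iterDomain_mem_nhds hfa hf0 hUn q)
      (iterDomain_mem_nhds hga hg0 hVn q)
  · intro h
    have hfqt := tendsto_zero_of_analyticAt (analyticAt_iterate hfa hf0 q)
      (Function.iterate_fixed hf0 q)
    exact (GermConj.of_iterate hq hlam hfa hga hf0 hg0 hmf hmg (h.germConj hfqt)).holLocallyConj
      hUn hVn
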